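/- arXiv:2403.12338 — 10 statements merged into one kernel-verified Lean document; each statement's English description precedes it below -/
import Mathlib

section
/- Let (x^n)_{n≥0} be generated by the inexact Halpern iteration x^n = (1−β_n)x^0 + β_n(Tx^{n−1} + U_n). Define κ_n = ‖Tx^n − x^0‖ and the sequence P_0 = 0, P_n = κ_{n−1}(β_n − β_{n−1}) + β_{n−1}P_{n−1} + β_n‖U_n‖ + β_{n−1}‖U_{n−1}‖ for n ≥ 1 (with conventions β_0 = 0 and U_0 = 0). Then for all n ≥ 1, ‖x^n − x^{n−1}‖ ≤ P_n, and moreover P_n = Σ_{i=1}^{n} B_i^{n−1}( κ_{i−1}(β_i − β_{i−1}) + β_i‖U_i‖ + β_{i−1}‖U_{i−1}‖ ). -/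
open Finset

/-- Closed form of the affine linear recursion `P (n + 1) = c (n + 1) + β n * P n`
started at `P 0 = 0`. -/
theorem affine_recursion_closed_form {R : Type*} [CommSemiring R] {β c P : ℕ → R}
    (hP0 : P 0 = 0) (hP : ∀ n, P (n + 1) = c (n + 1) + β n * P n) (n : ℕ) :
    P (n + 1) = ∑ i ∈ Finset.Icc 1 (n + 1), (∏ j ∈ Finset.Icc i n, β j) * c i := by
  induction n with
  | zero => simp [hP, hP0]
  | succ n ih =>
    rw [hP, ih, Finset.sum_Icc_succ_top (by omega : 1 ≤ n + 1 + 1), Finset.mul_sum, add_comm]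
    congr 1
    · refine Finset.sum_congr rfl fun i hi => ?_
      rw [Finset.prod_Icc_succ_top (Finset.mem_Icc.mp hi).2]
      ring
    · simp

/-- One-step increment estimate for two consecutive inexact Halpern updates anchored at `a`,
performed at the points `y` and `z`. -/
theorem norm_halpern_update_sub_le {E : Type*} [NormedAddCommGroup E] [NormedSpace ℝ E]
    {T : E → E} (hT : ∀ x y : E, ‖T x - T y‖ ≤ ‖x - y‖) {b b' : ℝ} (hb : 0 ≤ b) (hbb' : b ≤ b')
    (a y z u u' : E) :
    ‖((1 - b') • a + b' • (T z + u')) - ((1 - b) • a + b • (T y + u))‖ ≤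
      ‖T z - a‖ * (b' - b) + b * ‖z - y‖ + b' * ‖u'‖ + b * ‖u‖ := by
  have hdecomp : ((1 - b') • a + b' • (T z + u')) - ((1 - b) • a + b • (T y + u)) =
      (b' - b) • (T z - a) + b • (T z - T y) + b' • u' - b • u := by
    module
  calc _ ≤ ‖(b' - b) • (T z - a)‖ + ‖b • (T z - T y)‖ + ‖b' • u'‖ + ‖b • u‖ := by
        rw [hdecomp]
        exact (norm_sub_le _ _).trans (by gcongr; exact norm_add₃_le)
    _ = ‖T z - a‖ * (b' - b) + b * ‖T z - T y‖ + b' * ‖u'‖ + b * ‖u‖ := by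
        rw [norm_smul_of_nonneg (sub_nonneg.mpr hbb'), norm_smul_of_nonneg hb,
          norm_smul_of_nonneg (hb.trans hbb'), norm_smul_of_nonneg hb, mul_comm]
    _ ≤ _ := by gcongr; exact hT z y

/-- Recursive majorant `P` for the increments of the inexact
Halpern iteration, and its closed form. -/
theorem inexact_halpern_increment_bound
    (E : Type*) [NormedAddCommGroup E] [NormedSpace ℝ E] [FiniteDimensional ℝ E]
    (T : E → E) (hT : ∀ x y : E, ‖T x - T y‖ ≤ ‖x - y‖)
    (β : ℕ → ℝ) (hβ0 : β 0 = 0)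
    (hβ : ∀ n, 1 ≤ n → 0 < β n ∧ β n < 1)
    (hβmono : ∀ n, 1 ≤ n → β (n - 1) ≤ β n)
    (U : ℕ → E) (hU0 : U 0 = 0)
    (x : ℕ → E)
    (hx : ∀ n, 1 ≤ n → x n = (1 - β n) • x 0 + (β n) • (T (x (n - 1)) + U n))
    (κ : ℕ → ℝ) (hκ : ∀ n, κ n = ‖T (x n) - x 0‖)
    (P : ℕ → ℝ) (hP0 : P 0 = 0)
    (hP : ∀ n, 1 ≤ n → P n = κ (n - 1) * (β n - β (n - 1)) + β (n - 1) * P (n - 1)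
        + β n * ‖U n‖ + β (n - 1) * ‖U (n - 1)‖) :
    ∀ n, 1 ≤ n → ‖x n - x (n - 1)‖ ≤ P n ∧
      P n = ∑ i ∈ Finset.Icc 1 n,
        (∏ j ∈ Finset.Icc i (n - 1), β j) *
          (κ (i - 1) * (β i - β (i - 1)) + β i * ‖U i‖ + β (i - 1) * ‖U (i - 1)‖) := by
  have hP' : ∀ n, P (n + 1) = κ n * (β (n + 1) - β n) + β n * P n
      + β (n + 1) * ‖U (n + 1)‖ + β n * ‖U n‖ := fun n => hP (n + 1) n.succ_pos
  have hβ_nonneg : ∀ n, 0 ≤ β n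
    | 0 => hβ0.ge
    | n + 1 => (hβ (n + 1) n.succ_pos).1.le
  have hx' : ∀ n, x n = (1 - β n) • x 0 + β n • (T (x (n - 1)) + U n)
    | 0 => by simp [hβ0]
    | n + 1 => hx (n + 1) n.succ_pos
  have hbound : ∀ n, ‖x n - x (n - 1)‖ ≤ P n := by
    intro n
    induction n with
    | zero => simp [hP0]
    | succ n ih =>
      have hstep := norm_halpern_update_sub_le hT (hβ_nonneg n) (hβmono (n + 1) n.succ_pos)
        (x 0) (x (n - 1)) (x n) (U n) (U (n + 1))
      have hmul := mul_le_mul_of_nonneg_left ih (hβ_nonneg n)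
      rw [← hx' n, ← hκ n] at hstep
      have hsucc := hx' (n + 1)
      simp only [Nat.add_sub_cancel] at hsucc hstep ⊢
      rw [← hsucc] at hstep
      linarith [hP' n]
  rintro (_ | n) hn
  · omega
  · exact ⟨hbound _, affine_recursion_closed_form (β := β)
      (c := fun i => κ (i - 1) * (β i - β (i - 1)) + β i * ‖U i‖ + β (i - 1) * ‖U (i - 1)‖)
      hP0 (fun n => by simp only [Nat.add_sub_cancel]; linarith [hP' n]) n⟩
end

section
/- Let (x^n)_{n≥0} be generated by the inexact Halpern iteration x^n = (1−β_n)x^0 + β_n(Tx^{n−1} + U_n), and set κ_n = ‖Tx^n − x^0‖. Then for every n ≥ 1, ‖x^n − Tx^n‖ ≤ κ_n(1−β_n) + Σ_{i=1}^{n} B_i^{n}( κ_{i−1}(β_i − β_{i−1}) + β_i‖U_i‖ + β_{i−1}‖U_{i−1}‖ ) + β_n‖U_n‖. -/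
open Finset

/-- Extending a sum weighted by trailing products by one term multiplies it by the new factor. -/
theorem sum_prod_Icc_mul_succ {R : Type*} [CommRing R] (β c : ℕ → R) (n : ℕ) :
    ∑ i ∈ Icc 1 (n + 1), (∏ j ∈ Icc i (n + 1), β j) * c i =
      β (n + 1) * (∑ i ∈ Icc 1 n, (∏ j ∈ Icc i n, β j) * c i + c (n + 1)) := by
  rw [sum_Icc_succ_top (by omega), mul_add, mul_sum, Icc_self, prod_singleton]
  congr 1
  refine sum_congr rfl fun i hi => ?_
  have hin : i ≤ n + 1 := (mem_Icc.mp hi).2.trans n.le_succ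
  rw [prod_Icc_succ_top hin]
  ring

/-- The linear recursion `d (n + 1) ≤ c (n + 1) + β n * d n`, unrolled. -/
theorem mul_le_sum_prod_Icc_mul {β c d : ℕ → ℝ} (hβ : ∀ n, 0 ≤ β n) (hβ0 : β 0 = 0)
    (hd : ∀ n, d (n + 1) ≤ c (n + 1) + β n * d n) (n : ℕ) :
    β n * d n ≤ ∑ i ∈ Icc 1 n, (∏ j ∈ Icc i n, β j) * c i := by
  induction n with
  | zero => simp [hβ0]
  | succ n ih =>
    rw [sum_prod_Icc_mul_succ]
    exact mul_le_mul_of_nonneg_left (by linarith [hd n]) (hβ _)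

section Halpern

variable {E : Type*} [NormedAddCommGroup E] [NormedSpace ℝ E]

/-- Distance between two consecutive Halpern steps anchored at `a`, where `p`, `q` are the images
of the previous iterates and `u`, `v` the errors. -/
theorem norm_halpern_step_sub_le {s t : ℝ} (hs : 0 ≤ s) (hst : s ≤ t) (a p q u v : E) :
    ‖((1 - t) • a + t • (p + u)) - ((1 - s) • a + s • (q + v))‖ ≤
      ‖p - a‖ * (t - s) + t * ‖u‖ + s * ‖v‖ + s * ‖p - q‖ := by
  have key : ((1 - t) • a + t • (p + u)) - ((1 - s) • a + s • (q + v)) =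
      (t - s) • (p - a) + t • u - s • v + s • (p - q) := by module
  rw [key]
  calc _ ≤ ‖(t - s) • (p - a)‖ + ‖t • u‖ + ‖s • v‖ + ‖s • (p - q)‖ :=
        (norm_add_le _ _).trans <| by
          gcongr
          exact (norm_sub_le _ _).trans (by gcongr; exact norm_add_le _ _)
    _ = _ := by
        rw [norm_smul_of_nonneg (sub_nonneg.2 hst), norm_smul_of_nonneg (hs.trans hst),
          norm_smul_of_nonneg hs, norm_smul_of_nonneg hs, mul_comm (t - s)]

/-- Distance from a Halpern step anchored at `a` to an arbitrary point `r`. -/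
theorem norm_halpern_step_sub_point_le {t : ℝ} (ht : 0 ≤ t) (ht1 : t ≤ 1) (a p r u : E) :
    ‖((1 - t) • a + t • (p + u)) - r‖ ≤ ‖r - a‖ * (1 - t) + t * ‖r - p‖ + t * ‖u‖ := by
  have key : ((1 - t) • a + t • (p + u)) - r =
      (1 - t) • (a - r) + t • (p - r) + t • u := by module
  rw [key]
  refine norm_add₃_le.trans_eq ?_
  rw [norm_smul_of_nonneg (sub_nonneg.2 ht1), norm_smul_of_nonneg ht, norm_smul_of_nonneg ht,
    norm_sub_rev a, norm_sub_rev p, mul_comm (1 - t)]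

end Halpern

/-- Pathwise bound on the fixed-point residual of the inexact
Halpern iteration. -/
theorem inexact_halpern_residual_bound
    (E : Type*) [NormedAddCommGroup E] [NormedSpace ℝ E] [FiniteDimensional ℝ E]
    (T : E → E) (hT : ∀ x y : E, ‖T x - T y‖ ≤ ‖x - y‖)
    (β : ℕ → ℝ) (hβ0 : β 0 = 0)
    (hβ : ∀ n, 1 ≤ n → 0 < β n ∧ β n < 1)
    (hβmono : ∀ n, 1 ≤ n → β (n - 1) ≤ β n)
    (U : ℕ → E) (hU0 : U 0 = 0)
    (x : ℕ → E)
    (hx : ∀ n, 1 ≤ n → x n = (1 - β n) • x 0 + (β n) • (T (x (n - 1)) + U n))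
    (κ : ℕ → ℝ) (hκ : ∀ n, κ n = ‖T (x n) - x 0‖) :
    ∀ n, 1 ≤ n → ‖x n - T (x n)‖ ≤
      κ n * (1 - β n)
      + ∑ i ∈ Finset.Icc 1 n,
          (∏ j ∈ Finset.Icc i n, β j) *
            (κ (i - 1) * (β i - β (i - 1)) + β i * ‖U i‖ + β (i - 1) * ‖U (i - 1)‖)
      + β n * ‖U n‖ := by
  have hβ_nonneg : ∀ n, 0 ≤ β n := fun n => by
    rcases n.eq_zero_or_pos with rfl | hn
    exacts [hβ0.ge, (hβ n hn).1.le]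
  have hx' : ∀ n, x n = (1 - β n) • x 0 + β n • (T (x (n - 1)) + U n) := fun n => by
    rcases n.eq_zero_or_pos with rfl | hn
    exacts [by simp [hβ0], hx n hn]
  have hstep : ∀ n, β n * ‖x n - x (n - 1)‖ ≤ ∑ i ∈ Icc 1 n, (∏ j ∈ Icc i n, β j) *
      (κ (i - 1) * (β i - β (i - 1)) + β i * ‖U i‖ + β (i - 1) * ‖U (i - 1)‖) := by
    refine mul_le_sum_prod_Icc_mul hβ_nonneg hβ0 fun n => ?_
    have h := norm_halpern_step_sub_le (hβ_nonneg n) (hβmono (n + 1) n.succ_pos)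
      (x 0) (T (x n)) (T (x (n - 1))) (U (n + 1)) (U n)
    have hn1 := hx' (n + 1)
    simp only [Nat.add_sub_cancel] at hn1 ⊢
    rw [← hn1, ← hx' n, ← hκ] at h
    exact h.trans (by gcongr; exacts [hβ_nonneg n, hT _ _])
  intro n hn
  have h := norm_halpern_step_sub_point_le (hβ_nonneg n) (hβ n hn).2.le
    (x 0) (T (x (n - 1))) (T (x n)) (U n)
  rw [← hx' n, ← hκ] at h
  have hmul := mul_le_mul_of_nonneg_left (hT (x n) (x (n - 1))) (hβ_nonneg n)
  linarith [hstep n]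
end

section
/- (Proposition 3.1) Let (x^n)_{n≥0} be the random sequence generated by the stochastic inexact Halpern iteration x^n = (1−β_n)x^0 + β_n(Tx^{n−1} + U_n), where the error vectors U_n are random and integrable, and set σ_n = E‖U_n‖ with σ_0 = 0. Assume there is a constant κ̄ < ∞ with sup_{n≥0} E‖Tx^n − x^0‖ ≤ κ̄. Then for all n ≥ 1, E‖x^n − Tx^n‖ ≤ κ̄(1−β_n) + Σ_{i=1}^{n} B_i^{n}( κ̄(β_i − β_{i−1}) + β_i σ_i + β_{i−1} σ_{i−1} ) + β_n σ_n. -/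
open Finset MeasureTheory

/-- A nonexpansive map preserves integrability on a finite measure space. -/
lemma integrable_comp_of_nonexpansive {E Ω : Type*} [NormedAddCommGroup E] [MeasurableSpace Ω]
    {μ : Measure Ω} [IsFiniteMeasure μ] {T : E → E} (hT : ∀ x y : E, ‖T x - T y‖ ≤ ‖x - y‖)
    {f : Ω → E} (hf : Integrable f μ) : Integrable (fun ω => T (f ω)) μ := by
  have hc : Continuous T :=
    (LipschitzWith.of_dist_le_mul (K := 1) fun x y => by
      simpa [dist_eq_norm] using hT x y).continuous
  refine Integrable.mono' (hf.norm.add (integrable_const ‖T 0‖))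
    (hc.comp_aestronglyMeasurable hf.aestronglyMeasurable) (.of_forall fun ω => ?_)
  have h1 := hT (f ω) 0
  have h2 := norm_le_norm_add_norm_sub' (T (f ω)) (T 0)
  rw [sub_zero] at h1
  simp only [Pi.add_apply]
  linarith

/-- Recursion for sums weighted by trailing products. -/
lemma sum_Icc_prod_Icc_succ {R : Type*} [CommSemiring R] (β c : ℕ → R) (n : ℕ) :
    ∑ i ∈ Finset.Icc 1 (n + 1), (∏ j ∈ Finset.Icc i (n + 1), β j) * c i =
      β (n + 1) * (∑ i ∈ Finset.Icc 1 n, (∏ j ∈ Finset.Icc i n, β j) * c i + c (n + 1)) := by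
  rw [Finset.sum_Icc_succ_top (by omega), Finset.Icc_self, Finset.prod_singleton, mul_add,
    Finset.mul_sum]
  congr 1
  refine Finset.sum_congr rfl fun i hi => ?_
  rw [Finset.prod_Icc_succ_top (by grind)]
  ring

/-- **Proposition 3.1.** Bound on the expected fixed-point residual
of the stochastic inexact Halpern iteration. -/
theorem stochastic_halpern_expected_residual_bound
    (E : Type*) [NormedAddCommGroup E] [NormedSpace ℝ E] [FiniteDimensional ℝ E]
    (Ω : Type*) [MeasurableSpace Ω] (μ : Measure Ω) [IsProbabilityMeasure μ]
    (T : E → E) (hT : ∀ x y : E, ‖T x - T y‖ ≤ ‖x - y‖)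
    (β : ℕ → ℝ) (hβ0 : β 0 = 0)
    (hβ : ∀ n, 1 ≤ n → 0 < β n ∧ β n < 1)
    (hβmono : ∀ n, 1 ≤ n → β (n - 1) ≤ β n)
    (U : ℕ → Ω → E) (hU0 : ∀ ω, U 0 ω = 0)
    (hUint : ∀ n, Integrable (U n) μ)
    (x0 : E) (x : ℕ → Ω → E) (hx0 : ∀ ω, x 0 ω = x0)
    (hx : ∀ ω, ∀ n, 1 ≤ n →
      x n ω = (1 - β n) • x0 + (β n) • (T (x (n - 1) ω) + U n ω))
    (σ : ℕ → ℝ) (hσ : ∀ n, σ n = ∫ ω, ‖U n ω‖ ∂μ)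
    (κbar : ℝ) (hκbar : ∀ n, (∫ ω, ‖T (x n ω) - x0‖ ∂μ) ≤ κbar) :
    ∀ n, 1 ≤ n →
      (∫ ω, ‖x n ω - T (x n ω)‖ ∂μ) ≤
        κbar * (1 - β n)
        + ∑ i ∈ Finset.Icc 1 n,
            (∏ j ∈ Finset.Icc i n, β j) *
              (κbar * (β i - β (i - 1)) + β i * σ i + β (i - 1) * σ (i - 1))
        + β n * σ n := by
  have hx' : ∀ ω n, x n ω = (1 - β n) • x0 + β n • (T (x (n - 1) ω) + U n ω) := by
    intro ω n
    rcases Nat.eq_zero_or_pos n with rfl | hn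
    · simp [hβ0, hx0]
    · exact hx ω n hn
  have hβnn : ∀ n, 0 ≤ β n := by
    intro n
    rcases Nat.eq_zero_or_pos n with rfl | hn
    · exact hβ0.ge
    · exact (hβ n hn).1.le
  have hxint : ∀ n, Integrable (x n) μ := by
    intro n
    induction n with
    | zero => exact (integrable_const x0).congr (.of_forall fun ω => (hx0 ω).symm)
    | succ k ih =>
      exact ((integrable_const ((1 - β (k + 1)) • x0)).add
        (((integrable_comp_of_nonexpansive hT ih).add (hUint (k + 1))).smul
          (β (k + 1)))).congr (.of_forall fun ω => (hx' ω (k + 1)).symm)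
  have hTint : ∀ n, Integrable (fun ω => T (x n ω)) μ := fun n =>
    integrable_comp_of_nonexpansive hT (hxint n)
  have hκint : ∀ n, Integrable (fun ω => ‖T (x n ω) - x0‖) μ := fun n =>
    ((hTint n).sub (integrable_const x0)).norm
  have hDint : ∀ n, Integrable (fun ω => ‖x n ω - x (n - 1) ω‖) μ := fun n =>
    ((hxint n).sub (hxint (n - 1))).norm
  have hUn : ∀ n, Integrable (fun ω => ‖U n ω‖) μ := fun n => (hUint n).norm
  have hstep : ∀ n, ∫ ω, ‖x (n + 1) ω - x n ω‖ ∂μ ≤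
      β n * (∫ ω, ‖x n ω - x (n - 1) ω‖ ∂μ) +
        (κbar * (β (n + 1) - β n) + β (n + 1) * σ (n + 1) + β n * σ n) := by
    intro n
    have hm : 0 ≤ β (n + 1) - β n := sub_nonneg.2 (hβmono (n + 1) (by omega))
    have hpt : ∀ ω, ‖x (n + 1) ω - x n ω‖ ≤
        β n * ‖x n ω - x (n - 1) ω‖ + (β (n + 1) - β n) * ‖T (x n ω) - x0‖ +
          β (n + 1) * ‖U (n + 1) ω‖ + β n * ‖U n ω‖ := by
      intro ω
      have e : x (n + 1) ω - x n ω = β n • (T (x n ω) - T (x (n - 1) ω)) +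
          (β (n + 1) - β n) • (T (x n ω) - x0) + β (n + 1) • U (n + 1) ω +
            (-β n) • U n ω := by
        have h1 := hx' ω (n + 1)
        rw [Nat.add_sub_cancel] at h1
        rw [h1]
        nth_rewrite 2 [hx' ω n]
        module
      rw [e]
      refine norm_add₄_le.trans ?_
      simp only [norm_smul, Real.norm_eq_abs, abs_neg, abs_of_nonneg (hβnn _), abs_of_nonneg hm]
      gcongr
      · exact hβnn n
      · exact hT _ _
    have i1 := (hDint n).const_mul (β n)
    have i2 := (hκint n).const_mul (β (n + 1) - β n)
    have i3 := (hUn (n + 1)).const_mul (β (n + 1))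
    have i4 := (hUn n).const_mul (β n)
    have hI := integral_mono (hDint (n + 1)) (((i1.add i2).add i3).add i4) hpt
    rw [integral_add' ((i1.add i2).add i3) i4, integral_add' (i1.add i2) i3,
      integral_add' i1 i2] at hI
    simp only [integral_const_mul, ← hσ, Nat.add_sub_cancel] at hI
    have := mul_le_mul_of_nonneg_left (hκbar n) hm
    linarith
  have hsum : ∀ n, β n * (∫ ω, ‖x n ω - x (n - 1) ω‖ ∂μ) ≤
      ∑ i ∈ Finset.Icc 1 n, (∏ j ∈ Finset.Icc i n, β j) *
        (κbar * (β i - β (i - 1)) + β i * σ i + β (i - 1) * σ (i - 1)) := by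
    intro n
    induction n with
    | zero => simp
    | succ k ih =>
      rw [sum_Icc_prod_Icc_succ β
        (fun i => κbar * (β i - β (i - 1)) + β i * σ i + β (i - 1) * σ (i - 1))]
      refine mul_le_mul_of_nonneg_left ?_ (hβnn _)
      simp only [Nat.add_sub_cancel]
      exact (hstep k).trans (by gcongr)
  intro n hn
  have hm : 0 ≤ 1 - β n := sub_nonneg.2 (hβ n hn).2.le
  have hpt : ∀ ω, ‖x n ω - T (x n ω)‖ ≤ (1 - β n) * ‖T (x n ω) - x0‖ +
      β n * ‖x n ω - x (n - 1) ω‖ + β n * ‖U n ω‖ := by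
    intro ω
    have e : x n ω - T (x n ω) = (1 - β n) • (x0 - T (x n ω)) +
        β n • (T (x (n - 1) ω) - T (x n ω)) + β n • U n ω := by
      nth_rewrite 1 [hx' ω n]
      module
    rw [e]
    refine norm_add₃_le.trans ?_
    rw [norm_smul, norm_smul, norm_smul, norm_sub_rev x0, norm_sub_rev (T (x (n - 1) ω)),
      Real.norm_of_nonneg hm, Real.norm_of_nonneg (hβnn n)]
    gcongr
    · exact hβnn n
    · exact hT _ _
  have i1 := (hκint n).const_mul (1 - β n)
  have i2 := (hDint n).const_mul (β n)
  have i3 := (hUn n).const_mul (β n)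
  have hI := integral_mono ((hxint n).sub (hTint n)).norm ((i1.add i2).add i3) hpt
  rw [integral_add' (i1.add i2) i3, integral_add' i1 i2] at hI
  simp only [integral_const_mul, ← hσ, Pi.sub_apply] at hI
  have := mul_le_mul_of_nonneg_left (hκbar n) hm
  linarith [hsum n]
end

section
/- Let (x^n)_{n≥0} be generated by the inexact Halpern iteration x^n = (1−β_n)x^0 + β_n(Tx^{n−1} + U_n), and let x* be any fixed point of T. Then for every n ≥ 1, ‖x^n − x*‖ ≤ ‖x^0 − x*‖ + Σ_{i=1}^{n} B_i^{n} ‖U_i‖. -/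
open Finset

/-- Recursion in the upper index for sums weighted by tail products. -/
theorem sum_Icc_prod_Icc_mul_succ {R : Type*} [CommSemiring R] (b u : ℕ → R) (n : ℕ) :
    ∑ i ∈ Finset.Icc 1 (n + 1), (∏ j ∈ Finset.Icc i (n + 1), b j) * u i
      = b (n + 1) * (∑ i ∈ Finset.Icc 1 n, (∏ j ∈ Finset.Icc i n, b j) * u i + u (n + 1)) := by
  rw [Finset.sum_Icc_succ_top (by omega), mul_add, Finset.mul_sum]
  congr 1
  · refine Finset.sum_congr rfl fun i hi => ?_
    rw [Finset.prod_Icc_succ_top (by have := (Finset.mem_Icc.mp hi).2; omega)]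
    ring
  · simp

/-- Pathwise bound on the distance of the inexact Halpern
iterates to any fixed point of `T`. -/
theorem inexact_halpern_distance_to_fixed_point
    (E : Type*) [NormedAddCommGroup E] [NormedSpace ℝ E] [FiniteDimensional ℝ E]
    (T : E → E) (hT : ∀ x y : E, ‖T x - T y‖ ≤ ‖x - y‖)
    (β : ℕ → ℝ) (hβ0 : β 0 = 0)
    (hβ : ∀ n, 1 ≤ n → 0 < β n ∧ β n < 1)
    (hβmono : ∀ n, 1 ≤ n → β (n - 1) ≤ β n)
    (U : ℕ → E)
    (x : ℕ → E)
    (hx : ∀ n, 1 ≤ n → x n = (1 - β n) • x 0 + (β n) • (T (x (n - 1)) + U n))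
    (xstar : E) (hstar : T xstar = xstar) :
    ∀ n, 1 ≤ n →
      ‖x n - xstar‖ ≤ ‖x 0 - xstar‖
        + ∑ i ∈ Finset.Icc 1 n, (∏ j ∈ Finset.Icc i n, β j) * ‖U i‖ := by
  have bound : ∀ n, ‖x n - xstar‖ ≤ ‖x 0 - xstar‖
      + ∑ i ∈ Finset.Icc 1 n, (∏ j ∈ Finset.Icc i n, β j) * ‖U i‖ := by
    intro n
    induction n with
    | zero => simp
    | succ n ih =>
      obtain ⟨hpos, hlt⟩ := hβ (n + 1) (by omega)
      have hstep : x (n + 1) - xstar = (1 - β (n + 1)) • (x 0 - xstar)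
          + β (n + 1) • ((T (x n) - T xstar) + U (n + 1)) := by
        rw [hx (n + 1) (by omega), hstar, Nat.add_sub_cancel]
        module
      rw [sum_Icc_prod_Icc_mul_succ β (fun i => ‖U i‖) n, hstep]
      calc _ ≤ (1 - β (n + 1)) * ‖x 0 - xstar‖
            + β (n + 1) * ‖(T (x n) - T xstar) + U (n + 1)‖ := by
            refine (norm_add_le _ _).trans_eq ?_
            rw [norm_smul_of_nonneg (by linarith), norm_smul_of_nonneg hpos.le]
        _ ≤ (1 - β (n + 1)) * ‖x 0 - xstar‖ + β (n + 1) * ((‖x 0 - xstar‖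
            + ∑ i ∈ Finset.Icc 1 n, (∏ j ∈ Finset.Icc i n, β j) * ‖U i‖) + ‖U (n + 1)‖) := by
            gcongr
            exact (norm_add_le _ _).trans (by gcongr; exact (hT _ _).trans ih)
        _ = _ := by ring
  exact fun n _ => bound n
end

section
/- (Theorem 3.3, explicit form) Let (x^n)_{n≥0} be generated by the stochastic inexact Halpern iteration with stepsize β_n = n/(n+1), integrable random errors U_n, and σ_n = E‖U_n‖. Assume there is κ̄ < ∞ with sup_{n≥0} E‖Tx^n − x^0‖ ≤ κ̄. Then for every N ≥ 1, E‖x^N − Tx^N‖ ≤ (1/(N+1)) ( κ̄ + κ̄ Σ_{n=1}^{N} 1/(n+1) + 2 Σ_{n=1}^{N} n σ_n ). -/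
open Finset MeasureTheory

section Halpern

variable {E : Type*} [NormedAddCommGroup E] [NormedSpace ℝ E]

/-- One-step recursion for the consecutive differences of the inexact Halpern iteration. -/
lemma halpern_succ_mul_norm_sub_le {T : E → E} (hT : ∀ x y : E, ‖T x - T y‖ ≤ ‖x - y‖)
    {x U : ℕ → E} {x0 : E}
    (hx : ∀ n : ℕ, x n = (1 - (n : ℝ) / (n + 1)) • x0
      + ((n : ℝ) / (n + 1)) • (T (x (n - 1)) + U n)) (k : ℕ) :
    ((k : ℝ) + 1) * ‖x (k + 1) - x k‖ ≤
      1 / ((k : ℝ) + 2) * ‖T (x k) - x0‖ + k * ‖x k - x (k - 1)‖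
        + (k + 1) * ‖U (k + 1)‖ + k * ‖U k‖ := by
  have hk : (0 : ℝ) ≤ k := k.cast_nonneg
  have h1 : ((k : ℝ) + 1) • (x (k + 1) - x k) =
      (1 / ((k : ℝ) + 2)) • (T (x k) - x0) + (k : ℝ) • (T (x k) - T (x (k - 1)))
        + (((k : ℝ) + 1) * ((k + 1) / (k + 2))) • U (k + 1) - (k : ℝ) • U k := by
    have h2 := hx (k + 1)
    have h3 := hx k
    simp only [Nat.add_sub_cancel] at h2
    push_cast at h2
    generalize T (x k) = a at *
    generalize T (x (k - 1)) = b at *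
    rw [h2, h3]
    match_scalars <;> field_simp <;> ring
  have h4 : ((k : ℝ) + 1) * ((k + 1) / (k + 2)) ≤ k + 1 := by
    refine mul_le_of_le_one_right (by positivity) ?_
    rw [div_le_one (by positivity)]
    linarith
  calc ((k : ℝ) + 1) * ‖x (k + 1) - x k‖ = ‖((k : ℝ) + 1) • (x (k + 1) - x k)‖ := by
        rw [norm_smul_of_nonneg (by positivity)]
    _ ≤ ‖(1 / ((k : ℝ) + 2)) • (T (x k) - x0)‖ + ‖(k : ℝ) • (T (x k) - T (x (k - 1)))‖
        + ‖(((k : ℝ) + 1) * ((k + 1) / (k + 2))) • U (k + 1)‖ + ‖(k : ℝ) • U k‖ := by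
        rw [h1]
        exact (norm_sub_le _ _).trans (by gcongr; exact norm_add₃_le)
    _ ≤ _ := by
        rw [norm_smul_of_nonneg (by positivity), norm_smul_of_nonneg hk,
          norm_smul_of_nonneg (by positivity), norm_smul_of_nonneg hk]
        gcongr
        exact hT _ _

/-- Telescoped bound on the consecutive differences of the inexact Halpern iteration. -/
lemma halpern_mul_norm_sub_le {T : E → E} (hT : ∀ x y : E, ‖T x - T y‖ ≤ ‖x - y‖)
    {x U : ℕ → E} {x0 : E}
    (hx : ∀ n : ℕ, x n = (1 - (n : ℝ) / (n + 1)) • x0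
      + ((n : ℝ) / (n + 1)) • (T (x (n - 1)) + U n)) (N : ℕ) :
    (N : ℝ) * ‖x N - x (N - 1)‖ + N * ‖U N‖ ≤
      ∑ n ∈ Icc 1 N, 1 / ((n : ℝ) + 1) * ‖T (x (n - 1)) - x0‖
        + 2 * ∑ n ∈ Icc 1 N, (n : ℝ) * ‖U n‖ := by
  induction N with
  | zero => simp
  | succ k ih =>
    have h := halpern_succ_mul_norm_sub_le hT hx k
    rw [sum_Icc_succ_top (by omega), sum_Icc_succ_top (by omega)]
    simp only [Nat.add_sub_cancel]
    push_cast
    rw [show (k : ℝ) + 1 + 1 = k + 2 by ring]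
    linarith

/-- Deterministic residual bound for the inexact Halpern iteration. -/
lemma halpern_residual_le {T : E → E} (hT : ∀ x y : E, ‖T x - T y‖ ≤ ‖x - y‖)
    {x U : ℕ → E} {x0 : E}
    (hx : ∀ n : ℕ, x n = (1 - (n : ℝ) / (n + 1)) • x0
      + ((n : ℝ) / (n + 1)) • (T (x (n - 1)) + U n)) (N : ℕ) :
    ‖x N - T (x N)‖ ≤ 1 / ((N : ℝ) + 1) *
      (‖T (x N) - x0‖ + ∑ n ∈ Icc 1 N, 1 / ((n : ℝ) + 1) * ‖T (x (n - 1)) - x0‖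
        + 2 * ∑ n ∈ Icc 1 N, (n : ℝ) * ‖U n‖) := by
  have hN : (0 : ℝ) ≤ N := N.cast_nonneg
  have h1 : ((N : ℝ) + 1) • (x N - T (x N)) =
      -(T (x N) - x0) + (N : ℝ) • (T (x (N - 1)) - T (x N)) + (N : ℝ) • U N := by
    have h3 := hx N
    generalize T (x N) = a at *
    generalize T (x (N - 1)) = b at *
    rw [h3]
    match_scalars <;> field_simp <;> ring
  have h2 : ((N : ℝ) + 1) * ‖x N - T (x N)‖ ≤
      ‖T (x N) - x0‖ + N * ‖x N - x (N - 1)‖ + N * ‖U N‖ := by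
    rw [← norm_smul_of_nonneg (by positivity), h1]
    refine norm_add₃_le.trans ?_
    rw [norm_neg, norm_smul_of_nonneg hN, norm_smul_of_nonneg hN, norm_sub_rev (x N)]
    gcongr
    exact hT _ _
  have h3 := halpern_mul_norm_sub_le hT hx N
  rw [one_div, inv_mul_eq_div, le_div_iff₀' (by positivity)]
  linarith

end Halpern

/-- **Theorem 3.3, explicit form.** Explicit bound on the expected
residual of the stochastic Halpern iteration with stepsize `β_n = n/(n+1)`. -/
theorem stochastic_halpern_rate_nonexpansive
    (E : Type*) [NormedAddCommGroup E] [NormedSpace ℝ E] [FiniteDimensional ℝ E]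
    (Ω : Type*) [MeasurableSpace Ω] (μ : Measure Ω) [IsProbabilityMeasure μ]
    (T : E → E) (hT : ∀ x y : E, ‖T x - T y‖ ≤ ‖x - y‖)
    (U : ℕ → Ω → E) (hUint : ∀ n, Integrable (U n) μ)
    (x0 : E) (x : ℕ → Ω → E) (hx0 : ∀ ω, x 0 ω = x0)
    (hx : ∀ ω, ∀ n, 1 ≤ n →
      x n ω = (1 - (n : ℝ) / (n + 1)) • x0
        + ((n : ℝ) / (n + 1)) • (T (x (n - 1) ω) + U n ω))
    (σ : ℕ → ℝ) (hσ : ∀ n, σ n = ∫ ω, ‖U n ω‖ ∂μ)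
    (κbar : ℝ) (hκbar : ∀ n, (∫ ω, ‖T (x n ω) - x0‖ ∂μ) ≤ κbar) :
    ∀ N, 1 ≤ N →
      (∫ ω, ‖x N ω - T (x N ω)‖ ∂μ) ≤
        (1 / ((N : ℝ) + 1)) *
          (κbar + κbar * (∑ n ∈ Finset.Icc 1 N, 1 / ((n : ℝ) + 1))
            + 2 * ∑ n ∈ Finset.Icc 1 N, (n : ℝ) * σ n) := by
  intro N _
  have hrec : ∀ ω, ∀ n : ℕ, x n ω = (1 - (n : ℝ) / (n + 1)) • x0
      + ((n : ℝ) / (n + 1)) • (T (x (n - 1) ω) + U n ω) := by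
    intro ω n
    rcases Nat.eq_zero_or_pos n with rfl | hn
    · simp [hx0]
    · exact hx ω n hn
  have hxint : ∀ n, Integrable (x n) μ := by
    intro n
    induction n with
    | zero => exact (integrable_const x0).congr (ae_of_all _ fun ω => (hx0 ω).symm)
    | succ k ih =>
      refine Integrable.congr ?_ (ae_of_all _ fun ω => (hrec ω (k + 1)).symm)
      exact (integrable_const _).add
        (((integrable_comp_of_nonexpansive hT ih).add (hUint (k + 1))).smul _)
  have hTint : ∀ n, Integrable (fun ω => T (x n ω)) μ := fun n =>
    integrable_comp_of_nonexpansive hT (hxint n)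
  have hκint : ∀ n, Integrable (fun ω => ‖T (x n ω) - x0‖) μ := fun n =>
    ((hTint n).sub (integrable_const x0)).norm
  have hS1 : Integrable (fun ω => ∑ n ∈ Icc 1 N,
      1 / ((n : ℝ) + 1) * ‖T (x (n - 1) ω) - x0‖) μ :=
    integrable_finsetSum _ fun n _ => (hκint (n - 1)).const_mul _
  have hS2 : Integrable (fun ω => ∑ n ∈ Icc 1 N, (n : ℝ) * ‖U n ω‖) μ :=
    integrable_finsetSum _ fun n _ => (hUint n).norm.const_mul _
  have hS : Integrable (fun ω => ‖T (x N ω) - x0‖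
      + ∑ n ∈ Icc 1 N, 1 / ((n : ℝ) + 1) * ‖T (x (n - 1) ω) - x0‖) μ := (hκint N).add hS1
  calc (∫ ω, ‖x N ω - T (x N ω)‖ ∂μ)
      ≤ ∫ ω, 1 / ((N : ℝ) + 1) * (‖T (x N ω) - x0‖
          + ∑ n ∈ Icc 1 N, 1 / ((n : ℝ) + 1) * ‖T (x (n - 1) ω) - x0‖
          + 2 * ∑ n ∈ Icc 1 N, (n : ℝ) * ‖U n ω‖) ∂μ :=
        integral_mono ((hxint N).sub (hTint N)).norm
          ((hS.add (hS2.const_mul 2)).const_mul _)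
          fun ω => halpern_residual_le (x := fun n => x n ω) (U := fun n => U n ω) hT (hrec ω) N
    _ = 1 / ((N : ℝ) + 1) * ((∫ ω, ‖T (x N ω) - x0‖ ∂μ)
          + ∑ n ∈ Icc 1 N, 1 / ((n : ℝ) + 1) * (∫ ω, ‖T (x (n - 1) ω) - x0‖ ∂μ)
          + 2 * ∑ n ∈ Icc 1 N, (n : ℝ) * σ n) := by
        rw [integral_const_mul, integral_add hS (hS2.const_mul 2),
          integral_add (hκint N) hS1, integral_const_mul,
          integral_finsetSum _ fun n _ => (hκint (n - 1)).const_mul _,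
          integral_finsetSum _ fun n _ => (hUint n).norm.const_mul _]
        simp only [integral_const_mul, hσ]
    _ ≤ _ := by
        rw [mul_comm κbar, sum_mul]
        gcongr with n _
        · exact hκbar N
        · exact hκbar (n - 1)
end

section
/- The map T = Q ∘ P_C : ℝ^d → ℝ^d is nonexpansive for the ℓ¹ norm, i.e. ‖Tx − Ty‖₁ ≤ ‖x − y‖₁ for all x, y ∈ ℝ^d, and its set of fixed points is exactly the singleton {x*}, where x* = (λ/2, λ/2, …, λ/2) ∈ ℝ^d. -/
open Finset

/-- One-dimensional projection onto the interval `[0, lam]`. -/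
noncomputable def projInterval (lam t : ℝ) : ℝ := max 0 (min lam t)

/-- The shift map `Q(x₁,…,x_D) = (lam − x_D, x₁, …, x_{D−1})` on `ℝ^(d+1)`. -/
noncomputable def shiftQ (d : ℕ) (lam : ℝ) (x : Fin (d + 1) → ℝ) : Fin (d + 1) → ℝ :=
  fun i => if h : i = 0 then lam - x (Fin.last d) else x (Fin.castSucc (i.pred h))

/-- Componentwise projection onto the cube `[0, lam]^(d+1)`. -/
noncomputable def projC (d : ℕ) (lam : ℝ) (x : Fin (d + 1) → ℝ) : Fin (d + 1) → ℝ :=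
  fun i => projInterval lam (x i)

/-- The operator `T = Q ∘ P_C`. -/
noncomputable def opT (d : ℕ) (lam : ℝ) (x : Fin (d + 1) → ℝ) : Fin (d + 1) → ℝ :=
  shiftQ d lam (projC d lam x)

@[simp]
theorem opT_zero (d : ℕ) (lam : ℝ) (x : Fin (d + 1) → ℝ) :
    opT d lam x 0 = lam - projInterval lam (x (Fin.last d)) := by
  simp [opT, shiftQ, projC]

@[simp]
theorem opT_succ (d : ℕ) (lam : ℝ) (x : Fin (d + 1) → ℝ) (i : Fin d) :
    opT d lam x i.succ = projInterval lam (x i.castSucc) := by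
  simp [opT, shiftQ, projC]

theorem abs_projInterval_sub_le (lam s t : ℝ) :
    |projInterval lam s - projInterval lam t| ≤ |s - t| := by
  unfold projInterval
  calc |max 0 (min lam s) - max 0 (min lam t)|
      ≤ |min lam s - min lam t| := by
        simpa using abs_max_sub_max_le_max 0 (min lam s) 0 (min lam t)
    _ ≤ |s - t| := by
        simpa using abs_min_sub_min_le_max lam s lam t

theorem projInterval_mem_Icc {lam : ℝ} (hlam : 0 ≤ lam) (t : ℝ) :
    projInterval lam t ∈ Set.Icc 0 lam :=
  ⟨le_max_left _ _, max_le hlam (min_le_left _ _)⟩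

theorem projInterval_of_mem_Icc {lam t : ℝ} (ht : t ∈ Set.Icc 0 lam) :
    projInterval lam t = t := by
  rw [projInterval, min_eq_right ht.2, max_eq_right ht.1]

theorem sum_abs_opT_sub_le (d : ℕ) (lam : ℝ) (x y : Fin (d + 1) → ℝ) :
    ∑ i, |opT d lam x i - opT d lam y i| ≤ ∑ i, |x i - y i| := by
  rw [Fin.sum_univ_succ, Fin.sum_univ_castSucc (fun i => |x i - y i|), add_comm]
  simp only [opT_zero, opT_succ, sub_sub_sub_cancel_left]
  refine add_le_add (Finset.sum_le_sum fun i _ => abs_projInterval_sub_le _ _ _) ?_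
  rw [abs_sub_comm]
  exact abs_projInterval_sub_le _ _ _

theorem opT_eq_self_iff {d : ℕ} {lam : ℝ} (hlam : 0 ≤ lam) (x : Fin (d + 1) → ℝ) :
    opT d lam x = x ↔ x = fun _ => lam / 2 := by
  constructor
  · intro hx
    have h_zero : lam - projInterval lam (x (Fin.last d)) = x 0 := by
      rw [← opT_zero, hx]
    have h_succ (i : Fin d) : projInterval lam (x i.castSucc) = x i.succ := by
      rw [← opT_succ, hx]
    have h_mem (i : Fin (d + 1)) : x i ∈ Set.Icc 0 lam := by
      cases i using Fin.cases with
      | zero =>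
        obtain ⟨h₀, h₁⟩ := projInterval_mem_Icc hlam (x (Fin.last d))
        constructor <;> linarith
      | succ i => exact h_succ i ▸ projInterval_mem_Icc hlam _
    have h_const (i : Fin (d + 1)) : x i = x 0 := by
      induction i using Fin.induction with
      | zero => rfl
      | succ i ih => rw [← h_succ, projInterval_of_mem_Icc (h_mem _), ih]
    rw [projInterval_of_mem_Icc (h_mem _), h_const] at h_zero
    funext i
    rw [h_const]
    linarith
  · rintro rfl
    have h_proj : projInterval lam (lam / 2) = lam / 2 :=
      projInterval_of_mem_Icc ⟨by linarith, by linarith⟩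
    funext i
    cases i using Fin.cases with
    | zero => rw [opT_zero, h_proj, sub_half]
    | succ i => rw [opT_succ, h_proj]

/-- `T = Q ∘ P_C` is nonexpansive for the ℓ¹ norm and its
fixed-point set is exactly `{(lam/2, …, lam/2)}`. -/
theorem opT_nonexpansive_l1_and_fixed_point_unique
    (d : ℕ) (lam : ℝ) (hlam : 0 < lam) :
    (∀ x y : Fin (d + 1) → ℝ,
      (∑ i, |opT d lam x i - opT d lam y i|) ≤ ∑ i, |x i - y i|) ∧
    {x : Fin (d + 1) → ℝ | opT d lam x = x} = {fun _ => lam / 2} := by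
  exact ⟨sum_abs_opT_sub_le d lam, Set.ext fun x => opT_eq_self_iff hlam.le x⟩
end

section
/- (Lemma A.1) Define the progress of x ∈ ℝ^d by prog(x) = max{ i ∈ {1, …, d} : |x_i| > 0 } and prog(0) = 0. For every x ∈ ℝ^d with prog(x) < d, one has ‖x − Tx‖₁ ≥ λ, where T = Q ∘ P_C. -/
open Finset

open Classical in
/-- The progress of a vector: one plus the largest (0-based) index of a nonzero
coordinate, and `0` for the zero vector. -/
noncomputable def prog (d : ℕ) (x : Fin (d + 1) → ℝ) : ℕ :=
  (Finset.univ.filter fun i : Fin (d + 1) => 0 < |x i|).sup fun i => i.1 + 1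

theorem last_eq_zero_of_prog_lt {d : ℕ} {x : Fin (d + 1) → ℝ} (hx : prog d x < d + 1) :
    x (Fin.last d) = 0 := by
  classical
  by_contra h
  refine absurd hx (not_lt.mpr ?_)
  unfold prog
  exact Finset.le_sup (f := fun i : Fin (d + 1) => i.1 + 1) (b := Fin.last d)
    (by simpa using h)

theorem projInterval_zero {lam : ℝ} (hlam : 0 ≤ lam) : projInterval lam 0 = 0 := by
  simp [projInterval, hlam]

theorem sub_projInterval_le_abs {lam s : ℝ} (hs : s ≤ lam) (t : ℝ) :
    s - projInterval lam t ≤ |t - s| := by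
  have h : min lam t ≤ projInterval lam t := le_max_right _ _
  rcases min_choice lam t with h' | h' <;> rw [h'] at h
  · linarith [abs_nonneg (t - s)]
  · linarith [neg_abs_le (t - s)]

theorem projInterval_le {lam : ℝ} (hlam : 0 ≤ lam) (t : ℝ) : projInterval lam t ≤ lam :=
  max_le hlam (min_le_left _ _)

/-- **Lemma A.1.** If `prog(x)` is smaller than the dimension,
then the ℓ¹ fixed-point residual of `x` is at least `lam`. -/
theorem l1_residual_lower_bound_of_prog_lt
    (d : ℕ) (lam : ℝ) (hlam : 0 < lam) (x : Fin (d + 1) → ℝ)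
    (hx : prog d x < d + 1) :
    lam ≤ ∑ i, |x i - opT d lam x i| := by
  have h_last := last_eq_zero_of_prog_lt hx
  have h_first : lam - projInterval lam (x 0) ≤ |x 0 - opT d lam x 0| := by
    simpa [opT, shiftQ, projC, h_last, projInterval_zero hlam.le] using
      sub_projInterval_le_abs le_rfl (x 0)
  have h_succ : ∑ i : Fin d, (projInterval lam (x i.castSucc) - projInterval lam (x i.succ)) ≤
      ∑ i : Fin d, |x i.succ - opT d lam x i.succ| := by
    refine Finset.sum_le_sum fun i _ => ?_
    simpa [opT, shiftQ, projC] using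
      sub_projInterval_le_abs (projInterval_le hlam.le (x i.castSucc)) (x i.succ)
  have h_telescope := (Fin.sum_univ_succ fun i => projInterval lam (x i)).symm.trans
    (Fin.sum_univ_castSucc fun i => projInterval lam (x i))
  rw [h_last, projInterval_zero hlam.le] at h_telescope
  rw [Finset.sum_sub_distrib] at h_succ
  rw [Fin.sum_univ_succ]
  linarith
end

section
/- (Proposition 4.1) Let T : ℝ^d → ℝ^d be a γ-contraction for a norm ‖·‖, γ ∈ (0,1), with unique fixed point x*, and let (x^n)_{n≥0} be generated by the inexact Halpern iteration x^n = (1−β_n)x^0 + β_n(Tx^{n−1} + U_n) with an increasing sequence (β_n) ⊂ (0,1) and arbitrary error vectors U_n ∈ ℝ^d. Then for every n ≥ 1, ‖x^n − x*‖ ≤ Σ_{i=0}^{n} γ^{n−i} B_{i+1}^{n} ( (1−β_i)‖x^0 − x*‖ + β_i‖U_i‖ ), where β_0 = 0, U_0 = 0, B_i^n = Π_{j=i}^{n} β_j and B_i^n = 1 if i > n. -/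
open Finset

/-- The weighted sum `∑ i ≤ n, γ ^ (n - i) * (∏ i < j ≤ n, β j) * a i` is the solution of the linear
recursion `s (n + 1) = γ * β (n + 1) * s n + a (n + 1)`. -/
lemma sum_pow_mul_prod_Icc_succ {R : Type*} [CommSemiring R] (γ : R) (β a : ℕ → R) (n : ℕ) :
    ∑ i ∈ Finset.range (n + 1 + 1), γ ^ (n + 1 - i) * (∏ j ∈ Finset.Icc (i + 1) (n + 1), β j) * a i =
      γ * β (n + 1) *
        ∑ i ∈ Finset.range (n + 1), γ ^ (n - i) * (∏ j ∈ Finset.Icc (i + 1) n, β j) * a i +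
      a (n + 1) := by
  rw [Finset.sum_range_succ, Finset.mul_sum]
  congr 1
  · refine Finset.sum_congr rfl fun i hi => ?_
    have hin : i ≤ n := Nat.lt_succ_iff.mp (Finset.mem_range.mp hi)
    rw [Finset.prod_Icc_succ_top (by lia), Nat.succ_sub hin, pow_succ]
    ring
  · simp

/-- One step of the inexact Halpern iteration. -/
lemma norm_inexact_halpern_step_sub_le {E : Type*} [SeminormedAddCommGroup E] [NormedSpace ℝ E]
    {γ b : ℝ} {T : E → E} (hT : ∀ x y : E, ‖T x - T y‖ ≤ γ * ‖x - y‖)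
    {p : E} (hp : T p = p) (hb0 : 0 ≤ b) (hb1 : b ≤ 1) (x₀ y u : E) :
    ‖(1 - b) • x₀ + b • (T y + u) - p‖ ≤
      γ * b * ‖y - p‖ + ((1 - b) * ‖x₀ - p‖ + b * ‖u‖) := by
  have hsplit : (1 - b) • x₀ + b • (T y + u) - p =
      (1 - b) • (x₀ - p) + b • (T y - T p) + b • u := by
    rw [hp]
    module
  calc ‖(1 - b) • x₀ + b • (T y + u) - p‖
      ≤ ‖(1 - b) • (x₀ - p)‖ + ‖b • (T y - T p)‖ + ‖b • u‖ := hsplit ▸ norm_add₃_le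
    _ = (1 - b) * ‖x₀ - p‖ + b * ‖T y - T p‖ + b * ‖u‖ := by
      rw [norm_smul_of_nonneg (sub_nonneg.mpr hb1), norm_smul_of_nonneg hb0,
        norm_smul_of_nonneg hb0]
    _ ≤ (1 - b) * ‖x₀ - p‖ + b * (γ * ‖y - p‖) + b * ‖u‖ := by
      gcongr
      exact hT y p
    _ = γ * b * ‖y - p‖ + ((1 - b) * ‖x₀ - p‖ + b * ‖u‖) := by ring

/-- **Proposition 4.1.** Pathwise bound for the inexact Halpern
iteration applied to a `γ`-contraction. -/
theorem inexact_halpern_contraction_bound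
    (E : Type*) [NormedAddCommGroup E] [NormedSpace ℝ E] [FiniteDimensional ℝ E]
    (γ : ℝ) (hγ : γ ∈ Set.Ioo (0 : ℝ) 1)
    (T : E → E) (hT : ∀ x y : E, ‖T x - T y‖ ≤ γ * ‖x - y‖)
    (xstar : E) (hstar : T xstar = xstar)
    (β : ℕ → ℝ) (hβ0 : β 0 = 0)
    (hβ : ∀ n, 1 ≤ n → 0 < β n ∧ β n < 1)
    (hβmono : ∀ n, 1 ≤ n → β (n - 1) < β n)
    (U : ℕ → E) (hU0 : U 0 = 0)
    (x : ℕ → E)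
    (hx : ∀ n, 1 ≤ n → x n = (1 - β n) • x 0 + (β n) • (T (x (n - 1)) + U n)) :
    ∀ n, 1 ≤ n →
      ‖x n - xstar‖ ≤
        ∑ i ∈ Finset.range (n + 1),
          γ ^ (n - i) * (∏ j ∈ Finset.Icc (i + 1) n, β j) *
            ((1 - β i) * ‖x 0 - xstar‖ + β i * ‖U i‖) := by
  suffices h : ∀ n, ‖x n - xstar‖ ≤
      ∑ i ∈ Finset.range (n + 1),
        γ ^ (n - i) * (∏ j ∈ Finset.Icc (i + 1) n, β j) *
          ((1 - β i) * ‖x 0 - xstar‖ + β i * ‖U i‖) from fun n _ => h n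
  intro n
  induction n with
  | zero => simp [hβ0]
  | succ n ih =>
    obtain ⟨hpos, hlt⟩ := hβ (n + 1) n.succ_pos
    have hγβ : 0 ≤ γ * β (n + 1) := mul_nonneg hγ.1.le hpos.le
    rw [sum_pow_mul_prod_Icc_succ γ β fun i => (1 - β i) * ‖x 0 - xstar‖ + β i * ‖U i‖,
      hx (n + 1) n.succ_pos, Nat.add_sub_cancel]
    exact (norm_inexact_halpern_step_sub_le hT hstar hpos.le hlt.le _ _ _).trans
      (by gcongr)
end

section
/- (Theorem 4.2) Let T : ℝ^d → ℝ^d be a γ-contraction with γ ∈ (0,1) and unique fixed point x*, let N ≥ 1 be fixed, and let (x^n)_{0≤n≤N} be generated by the stochastic inexact Halpern iteration with stepsize β_n = n/(n+1) and integrable random errors U_n. Assume σ_n = E‖U_n‖ satisfies σ_n² ≤ σ²/(n² γ^{N−n}) for all 1 ≤ n ≤ N, for some constant σ > 0. Then E‖x^N − x*‖ ≤ ( ‖x^0 − x*‖ + 2σ ) / ( (1−γ)(N+1) ). -/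
open Finset MeasureTheory

/-- Discrete Grönwall bound for `b (n + 1) ≤ D + γ * b n + c n`. -/
lemma affine_recursion_bound {γ D : ℝ} (hγ : γ ∈ Set.Ioo (0 : ℝ) 1) (hD : 0 ≤ D)
    {b c : ℕ → ℝ} (h0 : b 0 ≤ D) (h : ∀ n, b (n + 1) ≤ D + γ * b n + c n) (n : ℕ) :
    b n ≤ D / (1 - γ) + ∑ k ∈ range n, γ ^ (n - 1 - k) * c k := by
  obtain ⟨hγ0, hγ1⟩ := hγ
  have h1 : 0 < 1 - γ := by linarith
  induction n with
  | zero =>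
    simp only [range_zero, sum_empty, add_zero]
    rw [le_div_iff₀ h1]
    nlinarith
  | succ n ih =>
    have hsum : ∑ k ∈ range (n + 1), γ ^ (n + 1 - 1 - k) * c k
        = γ * ∑ k ∈ range n, γ ^ (n - 1 - k) * c k + c n := by
      rw [sum_range_succ, mul_sum]
      congr 1
      · refine sum_congr rfl fun k hk => ?_
        have hk' := mem_range.1 hk
        rw [show n + 1 - 1 - k = (n - 1 - k) + 1 by omega, pow_succ]
        ring
      · simp
    have hfix : D + γ * (D / (1 - γ)) = D / (1 - γ) := by
      field_simp
      ring
    rw [hsum]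
    nlinarith [h n, mul_le_mul_of_nonneg_left ih hγ0.le]

/-- The scaled error of the inexact Halpern iteration satisfies an affine recursion. -/
lemma halpern_error_step {E : Type*} [NormedAddCommGroup E] [NormedSpace ℝ E] {γ : ℝ}
    {T : E → E} (hT : ∀ x y : E, ‖T x - T y‖ ≤ γ * ‖x - y‖) {p : E} (hp : T p = p)
    (n : ℕ) {x0 y z u : E}
    (hz : z = (1 - (n : ℝ) / (n + 1)) • x0 + ((n : ℝ) / (n + 1)) • (T y + u)) :
    ((n : ℝ) + 1) * ‖z - p‖ ≤ ‖x0 - p‖ + γ * (n * ‖y - p‖) + n * ‖u‖ := by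
  have hn : (0 : ℝ) < (n : ℝ) + 1 := by positivity
  have key : ((n : ℝ) + 1) • (z - p) = (x0 - p) + (n : ℝ) • ((T y - T p) + u) := by
    rw [hz, hp]
    match_scalars <;> field_simp <;> ring
  calc ((n : ℝ) + 1) * ‖z - p‖ = ‖((n : ℝ) + 1) • (z - p)‖ := by
        rw [norm_smul, Real.norm_of_nonneg hn.le]
    _ ≤ ‖x0 - p‖ + n * ‖(T y - T p) + u‖ := by
        rw [key]
        refine (norm_add_le _ _).trans_eq ?_
        rw [norm_smul, Real.norm_of_nonneg n.cast_nonneg]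
    _ ≤ ‖x0 - p‖ + n * (γ * ‖y - p‖ + ‖u‖) := by
        gcongr
        exact (norm_add_le _ _).trans (add_le_add_left (hT y p) _)
    _ = _ := by ring

/-- If `s ^ 2 ≤ σ ^ 2 / (m ^ 2 * γ ^ j)`, then `m * s` discounted by `γ ^ j`
is at most `σ * √γ ^ j`. -/
lemma discounted_noise_le {γ s σ m : ℝ} (hγ : 0 < γ) (hσ : 0 ≤ σ) (hm : 0 < m) (j : ℕ)
    (h : s ^ 2 ≤ σ ^ 2 / (m ^ 2 * γ ^ j)) : γ ^ j * (m * s) ≤ σ * √γ ^ j := by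
  have hr : √γ ^ j * √γ ^ j = γ ^ j := by rw [← mul_pow, Real.mul_self_sqrt hγ.le]
  have hr0 : 0 ≤ √γ ^ j := by positivity
  have h1 : √γ ^ j * (m * s) ≤ σ := by
    refine le_of_sq_le_sq ?_ hσ
    rw [le_div_iff₀ (by positivity)] at h
    calc (√γ ^ j * (m * s)) ^ 2 = s ^ 2 * (m ^ 2 * (√γ ^ j * √γ ^ j)) := by ring
      _ ≤ σ ^ 2 := by rwa [hr]
  calc γ ^ j * (m * s) = √γ ^ j * (√γ ^ j * (m * s)) := by rw [← hr]; ring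
    _ ≤ √γ ^ j * σ := by gcongr
    _ = σ * √γ ^ j := mul_comm _ _

/-- Partial geometric sums in `√γ` are at most `2 / (1 - γ)`. -/
lemma sum_sqrt_pow_le {γ : ℝ} (hγ : γ ∈ Set.Ioo (0 : ℝ) 1) (n : ℕ) :
    ∑ k ∈ range n, √γ ^ k ≤ 2 / (1 - γ) := by
  obtain ⟨hγ0, hγ1⟩ := hγ
  have hr0 : 0 ≤ √γ := Real.sqrt_nonneg γ
  have hr1 : √γ < 1 := by rw [Real.sqrt_lt' one_pos]; simpa using hγ1
  have hsq : √γ * √γ = γ := Real.mul_self_sqrt hγ0.le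
  have hgeom := geom_sum_mul_neg √γ n
  have hp : 0 ≤ √γ ^ n := by positivity
  rw [le_div_iff₀ (by linarith)]
  calc (∑ k ∈ range n, √γ ^ k) * (1 - γ) = (1 - √γ ^ n) * (1 + √γ) := by
        rw [← hgeom]; linear_combination (∑ k ∈ range n, √γ ^ k) * hsq
    _ ≤ 2 := by nlinarith [mul_nonneg hp hr0]

/-- **Theorem 4.2.** Expected distance to the fixed point of a
`γ`-contraction under the stochastic Halpern iteration with stepsize
`β_n = n/(n+1)` and suitably decaying noise. -/
theorem stochastic_halpern_contraction_rate
    (E : Type*) [NormedAddCommGroup E] [NormedSpace ℝ E] [FiniteDimensional ℝ E]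
    (Ω : Type*) [MeasurableSpace Ω] (μ : Measure Ω) [IsProbabilityMeasure μ]
    (γ : ℝ) (hγ : γ ∈ Set.Ioo (0 : ℝ) 1)
    (T : E → E) (hT : ∀ x y : E, ‖T x - T y‖ ≤ γ * ‖x - y‖)
    (xstar : E) (hstar : T xstar = xstar)
    (N : ℕ) (hN : 1 ≤ N)
    (U : ℕ → Ω → E) (hUint : ∀ n, Integrable (U n) μ)
    (x0 : E) (x : ℕ → Ω → E) (hx0 : ∀ ω, x 0 ω = x0)
    (hx : ∀ ω, ∀ n, 1 ≤ n →
      x n ω = (1 - (n : ℝ) / (n + 1)) • x0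
        + ((n : ℝ) / (n + 1)) • (T (x (n - 1) ω) + U n ω))
    (sig : ℝ) (hsig : 0 < sig)
    (hσ : ∀ n, 1 ≤ n → n ≤ N →
      (∫ ω, ‖U n ω‖ ∂μ) ^ 2 ≤ sig ^ 2 / ((n : ℝ) ^ 2 * γ ^ (N - n))) :
    (∫ ω, ‖x N ω - xstar‖ ∂μ) ≤
      (‖x0 - xstar‖ + 2 * sig) / ((1 - γ) * ((N : ℝ) + 1)) := by
  have hγ0 := hγ.1
  have h1γ : 0 < 1 - γ := by linarith [hγ.2]
  have hN1 : (0 : ℝ) < (N : ℝ) + 1 := by positivity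
  set D := ‖x0 - xstar‖
  have hpath : ∀ ω, ‖x N ω - xstar‖ ≤ (D / (1 - γ)
      + ∑ k ∈ range N, γ ^ (N - 1 - k) * (((k : ℝ) + 1) * ‖U (k + 1) ω‖)) / ((N : ℝ) + 1) := by
    intro ω
    rw [le_div_iff₀ hN1, mul_comm]
    refine affine_recursion_bound (b := fun n => ((n : ℝ) + 1) * ‖x n ω - xstar‖)
      hγ (norm_nonneg _) (by simp [hx0]) (fun n => ?_) N
    simpa using halpern_error_step hT hstar (n + 1) (hx ω (n + 1) (by omega))
  have hint : ∀ k ∈ range N,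
      Integrable (fun ω => γ ^ (N - 1 - k) * (((k : ℝ) + 1) * ‖U (k + 1) ω‖)) μ :=
    fun k _ => ((hUint (k + 1)).norm.const_mul _).const_mul _
  have hsum : ∑ k ∈ range N, γ ^ (N - 1 - k) * (((k : ℝ) + 1) * ∫ ω, ‖U (k + 1) ω‖ ∂μ)
      ≤ sig * (2 / (1 - γ)) := by
    calc _ ≤ ∑ k ∈ range N, sig * √γ ^ (N - 1 - k) := by
          refine sum_le_sum fun k hk => ?_
          have hk' := mem_range.1 hk
          refine discounted_noise_le hγ0 hsig.le (by positivity) _ ?_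
          have h := hσ (k + 1) (by omega) (by omega)
          rw [show N - (k + 1) = N - 1 - k by omega] at h
          exact_mod_cast h
      _ = sig * ∑ k ∈ range N, √γ ^ k := by
          rw [← mul_sum, sum_range_reflect (fun k => √γ ^ k) N]
      _ ≤ sig * (2 / (1 - γ)) := by
          gcongr
          exact sum_sqrt_pow_le hγ N
  calc (∫ ω, ‖x N ω - xstar‖ ∂μ)
      ≤ ∫ ω, (D / (1 - γ) + ∑ k ∈ range N,
          γ ^ (N - 1 - k) * (((k : ℝ) + 1) * ‖U (k + 1) ω‖)) / ((N : ℝ) + 1) ∂μ :=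
        integral_mono_of_nonneg (ae_of_all _ fun _ => norm_nonneg _)
          (((integrable_const _).add (integrable_finsetSum _ hint)).div_const _)
          (ae_of_all _ hpath)
    _ = (D / (1 - γ) + ∑ k ∈ range N,
          γ ^ (N - 1 - k) * (((k : ℝ) + 1) * ∫ ω, ‖U (k + 1) ω‖ ∂μ)) / ((N : ℝ) + 1) := by
        rw [integral_div, integral_add (integrable_const _) (integrable_finsetSum _ hint),
          integral_finsetSum _ hint]
        simp [integral_const_mul]
    _ ≤ (D / (1 - γ) + sig * (2 / (1 - γ))) / ((N : ℝ) + 1) := by gcongr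
    _ = (D + 2 * sig) / ((1 - γ) * ((N : ℝ) + 1)) := by
        field_simp
end

section
/- (Coupling of RVI and benchmark average-reward Halpern Q-learning) Fix v* ∈ ℝ, a function f : ℝ^{S×A} → ℝ satisfying f(Q + c·e) = f(Q) + c for every Q ∈ ℝ^{S×A} and c ∈ ℝ, stepsizes (β_n)_{n≥1} ⊂ (0,1), batch sizes (k_n)_{n≥1} ⊂ ℕ, and for each n ≥ 1, i ∈ {1,…,k_n} and (s,a) ∈ S×A an arbitrary sample state s_{n,i}(s,a) ∈ S. Define the empirical operators M̃_n Q(s,a) = r(s,a) + (1/k_n) Σ_{i=1}^{k_n} max_{a'∈A} Q(s_{n,i}(s,a), a') − f(Q) and H̃_n Q(s,a) = r(s,a) + (1/k_n) Σ_{i=1}^{k_n} max_{a'∈A} Q(s_{n,i}(s,a), a') − v*. Starting from a common Q^0 = Q_v^0, define Q^n = (1−β_n)Q^0 + β_n M̃_n Q^{n−1} and Q_v^n = (1−β_n)Q^0 + β_n H̃_n Q_v^{n−1} for n ≥ 1. Then for every n ≥ 0 there exists c_n ∈ ℝ with Q^n = Q_v^n + c_n·e; in particular ‖Q^n − M Q^n‖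 = ‖Q_v^n − H Q_v^n‖ for any pair of maps M, H : ℝ^{S×A} → ℝ^{S×A} with M(R + c·e) = M(R) + c·e − (whatever constant) — concretely, for the exact operators H Q(s,a) = r(s,a) + Σ_{s'} p(s'|s,a) max_{a'} Q(s',a') − v*, one has ‖H Q^n − Q^n‖_∞ = ‖H Q_v^n − Q_v^n‖_∞ for all n. -/
open Finset

/-- **Coupling of RVI and benchmark average-reward Halpern
Q-learning.** The iterates of the implementable algorithm (using `f`) and of
the benchmark algorithm (using the exact optimal gain `v*`), run with the same
samples from a common initial point, differ by a constant matrix at each step;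
in particular they have the same exact Bellman residual in the sup norm. -/
theorem average_reward_halpern_coupling
    (S A : Type*) [Fintype S] [Fintype A] [Nonempty S] [Nonempty A]
    (r : S × A → ℝ) (hr : ∀ sa, r sa ∈ Set.Icc (0 : ℝ) 1)
    (p : S × A → S → ℝ) (hp0 : ∀ sa s', 0 ≤ p sa s')
    (hp1 : ∀ sa, (∑ s', p sa s') = 1)
    (vstar : ℝ)
    (f : (S × A → ℝ) → ℝ)
    (hf : ∀ (Q : S × A → ℝ) (c : ℝ), f (fun sa => Q sa + c) = f Q + c)
    (β : ℕ → ℝ) (hβ : ∀ n, 1 ≤ n → β n ∈ Set.Ioo (0 : ℝ) 1)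
    (k : ℕ → ℕ) (hk : ∀ n, 0 < k n)
    (samp : ℕ → ℕ → S × A → S)
    (maxQ : (S × A → ℝ) → S → ℝ)
    (hmax : ∀ Q s', maxQ Q s' =
      Finset.univ.sup' Finset.univ_nonempty fun a' : A => Q (s', a'))
    (Mop : ℕ → (S × A → ℝ) → S × A → ℝ)
    (hM : ∀ n Q sa, Mop n Q sa =
      r sa + (1 / (k n : ℝ)) * (∑ i ∈ Finset.range (k n), maxQ Q (samp n i sa)) - f Q)
    (Hop : ℕ → (S × A → ℝ) → S × A → ℝ)
    (hH : ∀ n Q sa, Hop n Q sa =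
      r sa + (1 / (k n : ℝ)) * (∑ i ∈ Finset.range (k n), maxQ Q (samp n i sa)) - vstar)
    (Hex : (S × A → ℝ) → S × A → ℝ)
    (hHex : ∀ Q sa, Hex Q sa = r sa + (∑ s', p sa s' * maxQ Q s') - vstar)
    (Q0 : S × A → ℝ)
    (Q Qv : ℕ → S × A → ℝ) (hQ0 : Q 0 = Q0) (hQv0 : Qv 0 = Q0)
    (hQ : ∀ n, 1 ≤ n → ∀ sa,
      Q n sa = (1 - β n) * Q0 sa + β n * Mop n (Q (n - 1)) sa)
    (hQv : ∀ n, 1 ≤ n → ∀ sa,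
      Qv n sa = (1 - β n) * Q0 sa + β n * Hop n (Qv (n - 1)) sa) :
    ∀ n, (∃ c : ℝ, ∀ sa, Q n sa = Qv n sa + c) ∧
      (Finset.univ.sup' Finset.univ_nonempty
          fun sa : S × A => |Hex (Q n) sa - Q n sa|) =
        (Finset.univ.sup' Finset.univ_nonempty
          fun sa : S × A => |Hex (Qv n) sa - Qv n sa|) := by
  have max_shift : ∀ (P : S × A → ℝ) (c : ℝ) (s : S),
      maxQ (fun sa => P sa + c) s = maxQ P s + c := fun P c s => by
    rw [hmax, hmax, Finset.sup'_add]
  have avg_shift : ∀ (n : ℕ) (P : S × A → ℝ) (c : ℝ) (sa : S × A),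
      (1 / (k n : ℝ)) * (∑ i ∈ Finset.range (k n),
        maxQ (fun x => P x + c) (samp n i sa)) =
      (1 / (k n : ℝ)) * (∑ i ∈ Finset.range (k n), maxQ P (samp n i sa)) + c :=
    fun n P c sa => by
      have hkn : (k n : ℝ) ≠ 0 := Nat.cast_ne_zero.mpr (hk n).ne'
      simp only [max_shift, Finset.sum_add_distrib, Finset.sum_const, Finset.card_range,
        nsmul_eq_mul]
      field_simp
  have Hex_shift : ∀ (P : S × A → ℝ) (c : ℝ) (sa : S × A),
      Hex (fun x => P x + c) sa = Hex P sa + c := fun P c sa => by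
    simp only [hHex, max_shift, mul_add, Finset.sum_add_distrib, ← Finset.sum_mul, hp1]
    ring
  have coupling : ∀ n, ∃ c : ℝ, ∀ sa, Q n sa = Qv n sa + c := fun n => by
    induction n with
    | zero => exact ⟨0, fun sa => by rw [hQ0, hQv0, add_zero]⟩
    | succ n ih =>
      obtain ⟨c, hc⟩ := ih
      refine ⟨β (n + 1) * (vstar - f (Qv n)), fun sa => ?_⟩
      rw [hQ (n + 1) n.succ_pos, hQv (n + 1) n.succ_pos, Nat.add_sub_cancel, hM, hH, funext hc,
        avg_shift, hf]
      ring
  intro n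
  refine ⟨coupling n, ?_⟩
  obtain ⟨c, hc⟩ := coupling n
  simp only [funext hc, Hex_shift, add_sub_add_right_eq_sub]
end
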